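/- Let Γ be a graph satisfying the d-dimensional isoperimetric profile IS_d and let 1 ≤ p < d/2. If every bounded harmonic function on Γ whose gradient lies in ℓ^p(E) is constant, then for every q with 1 ≤ q < pd/(d+2p), the reduced ℓ^q-cohomology of Γ in degree one is trivial: D^q(Γ) equals the D^q-closure of ℓ^q(X) + ℝ·1. -/

import Mathlib

open scoped BigOperators ENNReal NNReal
open Filter Topology

/-- `f` is `p`-summable (`f ∈ ℓ^p`), for a real exponent `0 < p < ∞`. -/
def lpMem {ι : Type*} (p : ℝ) (f : ι → ℝ) : Prop := Summable fun i => |f i| ^ p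

/-- The `ℓ^q`-norm with exponent `q ∈ [1,∞]`, valued in `ℝ≥0∞`. -/
noncomputable def lpENorm {ι : Type*} (q : ℝ≥0∞) (f : ι → ℝ) : ℝ≥0∞ :=
  if q = ⊤ then ⨆ i, (‖f i‖₊ : ℝ≥0∞)
  else (∑' i, (‖f i‖₊ : ℝ≥0∞) ^ q.toReal) ^ (1 / q.toReal)

/-- A bounded real-valued function. -/
def BoundedFun {ι : Type*} (f : ι → ℝ) : Prop := ∃ M : ℝ, ∀ i, |f i| ≤ M

/-- A graph of bounded (locally finite) valency: each vertex has a finite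
set of neighbours, the adjacency is symmetric and there are no loops. -/
structure LFGraph (X : Type*) where
  nbr : X → Finset X
  symm : ∀ x y : X, y ∈ nbr x ↔ x ∈ nbr y
  loopless : ∀ x : X, x ∉ nbr x

namespace LFGraph

variable {X : Type*}

/-- Adjacency. -/
def Adj (G : LFGraph X) (x y : X) : Prop := y ∈ G.nbr x

/-- Connectivity of the graph. -/
def Conn (G : LFGraph X) : Prop := ∀ x y : X, Relation.ReflTransGen G.Adj x y

/-- The valency is bounded by `D`. -/
def BddVal (G : LFGraph X) (D : ℕ) : Prop := ∀ x : X, (G.nbr x).card ≤ D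

/-- The set of oriented edges. -/
abbrev Edge (G : LFGraph X) : Type _ := {e : X × X // e.2 ∈ G.nbr e.1}

/-- The gradient `∇g(x,y) = g(y) - g(x)` of a function on the vertices,
as a function on oriented edges. -/
def grad (G : LFGraph X) (g : X → ℝ) (e : G.Edge) : ℝ := g e.1.2 - g e.1.1

/-- `g ∈ D^p(Γ)`: the gradient of `g` is in `ℓ^p(E)` (`p` finite). -/
def MemDp (G : LFGraph X) (p : ℝ) (g : X → ℝ) : Prop := lpMem p (G.grad g)

/-- The `ℓ^p(E)`-norm of the gradient of `g`. -/
noncomputable def gradNorm (G : LFGraph X) (p : ℝ) (g : X → ℝ) : ℝ :=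
  (∑' e : G.Edge, |G.grad g e| ^ p) ^ (1 / p)

/-- The `D^p`-distance between `g` and `h`, with basepoint `e0`:
`‖∇(g-h)‖_{ℓ^p(E)} + |g(e0) - h(e0)|`. -/
noncomputable def dpDist (G : LFGraph X) (p : ℝ) (e0 : X) (g h : X → ℝ) : ℝ :=
  G.gradNorm p (fun x => g x - h x) + |g e0 - h e0|

/-- `g` belongs to the `D^p`-closure of `ℓ^p(X) + ℝ·1`, i.e. the class of `g`
in the degree one reduced `ℓ^p`-cohomology is trivial. -/
def InClos (G : LFGraph X) (p : ℝ) (e0 : X) (g : X → ℝ) : Prop :=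
  ∀ ε : ℝ, 0 < ε → ∃ (f : X → ℝ) (c : ℝ), lpMem p f ∧
    G.MemDp p (fun x => g x - (f x + c)) ∧
    G.dpDist p e0 g (fun x => f x + c) < ε

/-- `g` belongs to the `D^p`-closure of `ℓ^p(X)` (no constants). -/
def InClosLp (G : LFGraph X) (p : ℝ) (e0 : X) (g : X → ℝ) : Prop :=
  ∀ ε : ℝ, 0 < ε → ∃ f : X → ℝ, lpMem p f ∧
    G.MemDp p (fun x => g x - f x) ∧
    G.dpDist p e0 g f < ε

open Classical in
/-- The number of (oriented) boundary edges of a finite set `A` of vertices. -/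
noncomputable def bdry (G : LFGraph X) (A : Finset X) : ℕ :=
  ∑ x ∈ A, ((G.nbr x).filter fun y => y ∉ A).card

/-- The `d`-dimensional isoperimetric profile `IS_d`. -/
def ISdim (G : LFGraph X) (d : ℝ) : Prop :=
  ∃ κ : ℝ, 0 < κ ∧ ∀ A : Finset X, A.Nonempty →
    (A.card : ℝ) ^ (1 - 1 / d) ≤ κ * (G.bdry A : ℝ)

/-- The strong isoperimetric profile `IS_ω`. -/
def ISomega (G : LFGraph X) : Prop :=
  ∃ κ : ℝ, 0 < κ ∧ ∀ A : Finset X, A.Nonempty →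
    (A.card : ℝ) ≤ κ * (G.bdry A : ℝ)

/-- `h` is harmonic: at every vertex, the average of `h` over the
neighbours equals the value of `h`. -/
def Harmonic (G : LFGraph X) (h : X → ℝ) : Prop :=
  ∀ x : X, ∑ y ∈ G.nbr x, h y = ((G.nbr x).card : ℝ) * h x

/-- The graph is Liouville: every bounded harmonic function is constant. -/
def Liouville (G : LFGraph X) : Prop :=
  ∀ h : X → ℝ, G.Harmonic h → BoundedFun h → ∀ x y : X, h x = h y

open Classical in
/-- `walk G n x y` is the probability `P^{(n)}_x(y)` that the simple random
walk started at `x` is at `y` at time `n`. -/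
noncomputable def walk (G : LFGraph X) : ℕ → X → X → ℝ
  | 0, x, y => if y = x then 1 else 0
  | n + 1, x, y => (∑ z ∈ G.nbr x, walk G n z y) / ((G.nbr x).card : ℝ)

/-- `avg G n g x = ∑_y P^{(n)}_x(y) g(y)`, the expected value of `g` after `n`
steps of the simple random walk started at `x`. -/
noncomputable def avg (G : LFGraph X) (n : ℕ) (g : X → ℝ) (x : X) : ℝ :=
  ∑' y, G.walk n x y * g y

/-- The Markov operator of the simple random walk: average over the neighbours. -/
noncomputable def pAvg (G : LFGraph X) (f : X → ℝ) (x : X) : ℝ :=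
  (∑ y ∈ G.nbr x, f y) / ((G.nbr x).card : ℝ)

/-- Reachability in exactly `n` steps. -/
def reachN (G : LFGraph X) : ℕ → X → X → Prop
  | 0, x, y => y = x
  | n + 1, x, y => ∃ z ∈ G.nbr x, reachN G n z y

/-- The graph distance (the smallest `n` such that `y` is reachable from `x`
in `n` steps). -/
noncomputable def gdist (G : LFGraph X) (x y : X) : ℕ :=
  sInf {n : ℕ | G.reachN n x y}

/-- `f` is a quasi-isometry between the connected graphs `G` and `H`. -/
def QI {X Y : Type*} (G : LFGraph X) (H : LFGraph Y) (f : X → Y) : Prop :=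
  G.Conn ∧ H.Conn ∧ ∃ Λ C : ℝ, 1 ≤ Λ ∧ 0 ≤ C ∧
    (∀ x x' : X, (H.gdist (f x) (f x') : ℝ) ≤ Λ * (G.gdist x x') + C) ∧
    (∀ x x' : X, (G.gdist x x' : ℝ) ≤ Λ * (H.gdist (f x) (f x')) + C) ∧
    ∀ y : Y, ∃ x : X, (H.gdist (f x) y : ℝ) ≤ C

/-- Reachability avoiding the finite set `F`. -/
def reachAvoid (G : LFGraph X) (F : Finset X) : X → X → Prop :=
  Relation.ReflTransGen fun a b => b ∈ G.nbr a ∧ a ∉ F ∧ b ∉ F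

/-- The graph has at most one end: for every finite set `F` of vertices,
the complement of `F` has at most one infinite connected component. -/
def AtMostOneEnd (G : LFGraph X) : Prop :=
  ∀ F : Finset X, ∀ x y : X, x ∉ F → y ∉ F →
    {z | G.reachAvoid F x z}.Infinite → {z | G.reachAvoid F y z}.Infinite →
    G.reachAvoid F x y

end LFGraph

/-- The Cayley graph of a group with respect to a finite symmetric generating
set `S` not containing the identity: the neighbours of `x` are the `s * x`, `s ∈ S`. -/
def cayley {Γ : Type*} [Group Γ] [DecidableEq Γ] (S : Finset Γ)
    (hsym : ∀ s ∈ S, s⁻¹ ∈ S) (h1 : (1 : Γ) ∉ S) : LFGraph Γ where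
  nbr x := S.image fun s => s * x
  symm := by
    intro x y
    simp only [Finset.mem_image]
    constructor
    · rintro ⟨s, hs, rfl⟩
      exact ⟨s⁻¹, hsym s hs, by group⟩
    · rintro ⟨s, hs, rfl⟩
      exact ⟨s⁻¹, hsym s hs, by group⟩
  loopless := by
    intro x hx
    rw [Finset.mem_image] at hx
    obtain ⟨s, hs, hsx⟩ := hx
    have hs1 : s = 1 := by
      have h' : s * x = 1 * x := by rw [one_mul]; exact hsx
      exact mul_right_cancel h'
    exact h1 (hs1 ▸ hs)

/-- The ball of radius `n` in the word metric given by `S`. -/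
def cball {Γ : Type*} [Group Γ] [DecidableEq Γ] (S : Finset Γ) : ℕ → Finset Γ
  | 0 => {1}
  | n + 1 => cball S n ∪ (cball S n).biUnion fun x => S.image fun s => s * x

/-- Amenability of a group, via the Følner condition. -/
def Amenable (Γ : Type*) [Group Γ] [DecidableEq Γ] : Prop :=
  ∀ (T : Finset Γ) (ε : ℝ), 0 < ε → ∃ F : Finset Γ, F.Nonempty ∧
    ∀ t ∈ T, (((F.image fun x => t * x) \ F).card : ℝ) ≤ ε * (F.card : ℝ)
/-- An elementary inequality of Stroock–Varopoulos type, under the assumption `|b| ≤ a`. -/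
lemma sq_rpow_sub_rpow_le_of_abs_le {s m p a b : ℝ} (hs : 1 < s) (hm : 1 ≤ m)
    (h2m : 2 * m = s + p) (ha : 0 < a) (hab : |b| ≤ a) :
    (a ^ m - |b| ^ m) ^ 2 ≤
      m ^ 2 / min 1 (s - 1) * ((a - b) * (a * a ^ (s - 2) - b * |b| ^ (s - 2))) * a ^ p := by
  obtain ⟨t, rfl⟩ : ∃ t, b = t * a := ⟨b / a, by field_simp⟩
  have ht : |t| ≤ 1 := by
    rw [abs_mul, abs_of_pos ha] at hab
    exact le_of_mul_le_mul_right (by linarith) ha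
  set c := min 1 (s - 1) with hc
  have hc0 : 0 < c := lt_min one_pos (by linarith)
  have hc1 : c ≤ 1 := min_le_left _ _
  have key : (1 - |t| ^ m) ^ 2 ≤ m ^ 2 / c * ((1 - t) * (1 - t * |t| ^ (s - 2))) := by
    have hp0 : 0 ≤ |t| ^ m := Real.rpow_nonneg (abs_nonneg _) _
    have hp1 : |t| ^ m ≤ 1 := Real.rpow_le_one (abs_nonneg _) ht (by linarith)
    rcases le_or_gt t 0 with h0 | h0
    · have h1 : 1 ≤ m ^ 2 / c := by
        rw [le_div_iff₀ hc0]; nlinarith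
      have h2 : t * |t| ^ (s - 2) ≤ 0 :=
        mul_nonpos_of_nonpos_of_nonneg h0 (Real.rpow_nonneg (abs_nonneg _) _)
      have h3 : 1 ≤ (1 - t) * (1 - t * |t| ^ (s - 2)) := by nlinarith
      nlinarith
    · rw [abs_of_pos h0] at *
      have h1 : 1 - t ^ m ≤ m * (1 - t) := by
        have := one_add_mul_self_le_rpow_one_add (s := t - 1) (by linarith) hm
        rw [add_sub_cancel] at this
        linarith
      have e : t * t ^ (s - 2) = t ^ (s - 1) := by
        rw [← Real.rpow_one_add' h0.le (by linarith)]; congr 1; ring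
      have h2 : c * (1 - t) ≤ 1 - t ^ (s - 1) := by
        rcases le_total 1 (s - 1) with h | h
        · have : t ^ (s - 1) ≤ t ^ (1 : ℝ) :=
            Real.rpow_le_rpow_of_exponent_ge h0 ht h
          rw [Real.rpow_one] at this
          rw [hc, min_eq_left h]; linarith
        · have := rpow_one_add_le_one_add_mul_self (s := t - 1) (by linarith)
            (p := s - 1) (by linarith) h
          rw [add_sub_cancel] at this
          rw [hc, min_eq_right h]; linarith
      rw [e]
      calc (1 - t ^ m) ^ 2 ≤ (m * (1 - t)) ^ 2 := pow_le_pow_left₀ (by linarith) h1 2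
        _ = m ^ 2 / c * ((1 - t) * (c * (1 - t))) := by field_simp
        _ ≤ _ := by
            have : 0 ≤ 1 - t := by linarith
            gcongr
  have e1 : |t * a| ^ m = |t| ^ m * a ^ m := by
    rw [abs_mul, abs_of_pos ha, Real.mul_rpow (abs_nonneg _) ha.le]
  have e2 : |t * a| ^ (s - 2) = |t| ^ (s - 2) * a ^ (s - 2) := by
    rw [abs_mul, abs_of_pos ha, Real.mul_rpow (abs_nonneg _) ha.le]
  have e3 : (a ^ m) ^ 2 = a * a * a ^ (s - 2) * a ^ p := by
    rw [← Real.rpow_natCast, ← Real.rpow_mul ha.le]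
    nth_rewrite 2 [← Real.rpow_one a]
    nth_rewrite 3 [← Real.rpow_one a]
    rw [← Real.rpow_add ha, ← Real.rpow_add ha, ← Real.rpow_add ha]
    congr 1; push_cast; linarith
  rw [e1, e2]
  calc (a ^ m - |t| ^ m * a ^ m) ^ 2 = (1 - |t| ^ m) ^ 2 * (a ^ m) ^ 2 := by ring
    _ ≤ m ^ 2 / c * ((1 - t) * (1 - t * |t| ^ (s - 2))) * (a ^ m) ^ 2 := by gcongr
    _ = _ := by rw [e3]; ring

/-- An elementary inequality of Stroock–Varopoulos type. -/
lemma sq_abs_rpow_sub_abs_rpow_le {s m p : ℝ} (hs : 1 < s) (hm : 1 ≤ m)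
    (h2m : 2 * m = s + p) (a b : ℝ) :
    0 ≤ (a - b) * (a * |a| ^ (s - 2) - b * |b| ^ (s - 2)) ∧
    (|a| ^ m - |b| ^ m) ^ 2 ≤
      m ^ 2 / min 1 (s - 1) * ((a - b) * (a * |a| ^ (s - 2) - b * |b| ^ (s - 2))) *
        (|a| ^ p + |b| ^ p) := by
  have hc0 : 0 < min 1 (s - 1) := lt_min one_pos (by linarith)
  wlog hab : |b| ≤ |a| generalizing a b
  · obtain ⟨h1, h2⟩ := this b a (not_le.1 hab).le
    refine ⟨by linarith, ?_⟩
    calc _ = (|b| ^ m - |a| ^ m) ^ 2 := by ring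
      _ ≤ _ := h2
      _ = _ := by ring
  wlog ha : 0 ≤ a generalizing a b
  · have := this (-a) (-b) (by simpa using hab) (by linarith)
    simp only [abs_neg] at this
    obtain ⟨h1, h2⟩ := this
    refine ⟨by linarith, ?_⟩
    calc _ ≤ _ := h2
      _ = _ := by ring
  rcases ha.eq_or_lt with rfl | ha
  · have : b = 0 := by simpa using hab
    subst this
    simp
  rw [abs_of_pos ha] at *
  have h1 := sq_rpow_sub_rpow_le_of_abs_le hs hm h2m ha hab
  have hb : b ≤ a := (le_abs_self b).trans hab
  have h0 : 0 ≤ (a - b) * (a * a ^ (s - 2) - b * |b| ^ (s - 2)) := by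
    by_contra hneg
    push Not at hneg
    have hlt : a ≠ b := by rintro rfl; simp at hneg
    have hneg' : m ^ 2 / min 1 (s - 1) * ((a - b) * (a * a ^ (s - 2) - b * |b| ^ (s - 2))) *
        a ^ p < 0 := by
      apply mul_neg_of_neg_of_pos _ (Real.rpow_pos_of_pos ha _)
      exact mul_neg_of_pos_of_neg (by positivity) hneg
    linarith [sq_nonneg (a ^ m - |b| ^ m)]
  refine ⟨h0, h1.trans ?_⟩
  have : 0 ≤ |b| ^ p := Real.rpow_nonneg (abs_nonneg _) _
  apply mul_le_mul_of_nonneg_left (by linarith)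
  positivity

namespace LFGraph

variable {X : Type*}

open Classical in
/-- The `ℓ¹` Sobolev inequality which follows from an isoperimetric inequality. -/
lemma sobolev_of_isoperimetric (G : LFGraph X) {κ r : ℝ} (hr : 1 ≤ r)
    (hκ : ∀ A : Finset X, A.Nonempty → (A.card : ℝ) ^ (1 / r) ≤ κ * (G.bdry A : ℝ))
    (A : Finset X) (φ : X → ℝ) (h0 : ∀ x, 0 ≤ φ x) (hA : ∀ x ∉ A, φ x = 0) :
    (∑ x ∈ A, φ x ^ r) ^ (1 / r) ≤ κ * ∑ x ∈ A, ∑ y ∈ G.nbr x, max (φ x - φ y) 0 := by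
  induction A using Finset.strongInduction generalizing φ with
  | H A ih =>
  rcases A.eq_empty_or_nonempty with rfl | hne
  · simp [Real.zero_rpow (show r⁻¹ ≠ 0 by positivity)]
  obtain ⟨x₀, hx₀, hmin⟩ := A.exists_min_image φ hne
  set t := φ x₀ with ht
  have ht0 : 0 ≤ t := h0 _
  set ψ : X → ℝ := fun x => if x ∈ A then φ x - t else 0 with hψ
  have hψ0 : ∀ x, 0 ≤ ψ x := by
    intro x
    by_cases hx : x ∈ A
    · simpa [hψ, hx] using hmin x hx
    · simp [hψ, hx]
  have hψx₀ : ψ x₀ = 0 := by simp [hψ, hx₀, ht]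
  have ih' := ih (A.erase x₀) (Finset.erase_ssubset hx₀) ψ hψ0 (by
    intro x hx
    by_cases hxx : x = x₀
    · rw [hxx, hψx₀]
    · have : x ∉ A := fun h => hx (Finset.mem_erase.2 ⟨hxx, h⟩)
      simp [hψ, this])
  rw [Finset.sum_erase _ (by rw [hψx₀, Real.zero_rpow (by linarith)]),
    Finset.sum_erase _ (by
      apply Finset.sum_eq_zero
      intro y _
      rw [hψx₀]
      exact max_eq_right (by linarith [hψ0 y]))] at ih'
  have hφ : ∀ x ∈ A, φ x = t + ψ x := by
    intro x hx; simp [hψ, hx]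
  have hTV : ∑ x ∈ A, ∑ y ∈ G.nbr x, max (φ x - φ y) 0
      = t * (G.bdry A : ℝ) + ∑ x ∈ A, ∑ y ∈ G.nbr x, max (ψ x - ψ y) 0 := by
    rw [bdry, Nat.cast_sum, Finset.mul_sum, ← Finset.sum_add_distrib]
    apply Finset.sum_congr rfl
    intro x hx
    rw [Finset.card_filter, Nat.cast_sum, Finset.mul_sum, ← Finset.sum_add_distrib]
    apply Finset.sum_congr rfl
    intro y _
    by_cases hy : y ∈ A
    · rw [hφ x hx, hφ y hy, add_sub_add_left_eq_sub]
      rw [if_neg (not_not.2 hy), Nat.cast_zero, mul_zero, zero_add]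
    · have h1 : ψ y = 0 := by simp [hψ, hy]
      rw [hφ x hx, hA y hy, h1]
      simp only [hy, not_false_eq_true, if_true, Nat.cast_one, sub_zero, mul_one]
      rw [max_eq_left (hψ0 x), max_eq_left (add_nonneg ht0 (hψ0 x))]
  have hmink := Real.Lp_add_le_of_nonneg A (f := fun _ => t) (g := ψ) hr
    (fun _ _ => ht0) (fun x _ => hψ0 x)
  have hconst : (∑ _x ∈ A, t ^ r) ^ (1 / r) = t * (A.card : ℝ) ^ (1 / r) := by
    rw [Finset.sum_const, nsmul_eq_mul, Real.mul_rpow (Nat.cast_nonneg _) (Real.rpow_nonneg ht0 _),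
      ← Real.rpow_mul ht0, mul_one_div_cancel (by linarith), Real.rpow_one, mul_comm]
  rw [Finset.sum_congr rfl (fun x hx => by rw [hφ x hx] : ∀ x ∈ A, φ x ^ r = (t + ψ x) ^ r), hTV]
  calc _ ≤ _ := hmink
    _ ≤ t * (κ * (G.bdry A : ℝ)) + κ * ∑ x ∈ A, ∑ y ∈ G.nbr x, max (ψ x - ψ y) 0 := by
        rw [hconst]
        exact add_le_add (mul_le_mul_of_nonneg_left (hκ A hne) ht0) ih'
    _ = _ := by ring

/-- The (unnormalized) graph Laplacian. -/
def lap (G : LFGraph X) (f : X → ℝ) (x : X) : ℝ := ∑ y ∈ G.nbr x, (f x - f y)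

open Classical in
/-- The oriented edges with both ends in `B`. -/
noncomputable def edgesIn (G : LFGraph X) (B : Finset X) : Finset (X × X) :=
  (B ×ˢ B).filter fun e => e.2 ∈ G.nbr e.1

open Classical in
lemma sum_edgesIn (G : LFGraph X) (B : Finset X) (F : X → X → ℝ) :
    ∑ e ∈ G.edgesIn B, F e.1 e.2 = ∑ x ∈ B, ∑ y ∈ B with y ∈ G.nbr x, F x y := by
  rw [edgesIn, Finset.sum_filter, Finset.sum_product]
  exact Finset.sum_congr rfl fun x _ => (Finset.sum_filter _ _).symm

lemma sum_edgesIn_swap (G : LFGraph X) (B : Finset X) (F : X → X → ℝ) :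
    ∑ e ∈ G.edgesIn B, F e.2 e.1 = ∑ e ∈ G.edgesIn B, F e.1 e.2 := by
  refine Finset.sum_equiv (Equiv.prodComm X X) ?_ fun e _ => rfl
  intro e
  simp [edgesIn, G.symm e.1 e.2, and_comm]

lemma sum_edgesIn_fst_le (G : LFGraph X) {D : ℕ} (hval : G.BddVal D) (B : Finset X) (H : X → ℝ)
    (hH : ∀ x, 0 ≤ H x) : ∑ e ∈ G.edgesIn B, H e.1 ≤ D * ∑ x ∈ B, H x := by
  classical
  rw [G.sum_edgesIn B fun x _ => H x, Finset.mul_sum]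
  refine Finset.sum_le_sum fun x _ => ?_
  rw [Finset.sum_const, nsmul_eq_mul]
  refine mul_le_mul_of_nonneg_right ?_ (hH x)
  have h : ({y ∈ B | y ∈ G.nbr x} : Finset X) ⊆ G.nbr x := fun y hy => (Finset.mem_filter.1 hy).2
  exact_mod_cast (Finset.card_le_card h).trans (hval x)

/-- Green's formula for a function `φ` vanishing outside of `A`. -/
lemma sum_edgesIn_grad_mul_grad (G : LFGraph X) {A B : Finset X} (hAB : A ⊆ B)
    (hB : ∀ x ∈ A, G.nbr x ⊆ B) (f φ : X → ℝ) (hφ : ∀ x ∉ A, φ x = 0) :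
    ∑ e ∈ G.edgesIn B, (f e.1 - f e.2) * (φ e.1 - φ e.2) = 2 * ∑ x ∈ A, G.lap f x * φ x := by
  classical
  have h1 : ∑ e ∈ G.edgesIn B, (f e.1 - f e.2) * φ e.1 = ∑ x ∈ A, G.lap f x * φ x := by
    rw [G.sum_edgesIn B fun x y => (f x - f y) * φ x]
    symm
    apply Finset.sum_subset_zero_on_sdiff hAB
    · intro x hx
      rw [hφ x (Finset.mem_sdiff.1 hx).2]
      simp
    · intro x hx
      rw [lap, Finset.sum_mul]
      refine Finset.sum_congr ?_ fun _ _ => rfl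
      ext y
      simp only [Finset.mem_filter]
      exact ⟨fun h => ⟨hB x hx h, h⟩, fun h => h.2⟩
  have h2 := G.sum_edgesIn_swap B fun x y => (f x - f y) * φ x
  calc _ = ∑ e ∈ G.edgesIn B, ((f e.1 - f e.2) * φ e.1 + (f e.2 - f e.1) * φ e.2) :=
        Finset.sum_congr rfl fun e _ => by ring
    _ = _ := by rw [Finset.sum_add_distrib, h2, h1]; ring

/-- An a priori estimate for the Dirichlet problem `lap f = u` on a finite set of vertices. -/
lemma exists_dirichlet_estimate (G : LFGraph X) {D : ℕ} (hval : G.BddVal D) {d p : ℝ}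
    (hIS : G.ISdim d) (hp : 1 ≤ p) (hd : 2 < d) (hQ : 1 < p * d / (d + 2 * p)) :
    ∃ K : ℝ, 0 ≤ K ∧ ∀ (A : Finset X) (f : X → ℝ), (∀ x ∉ A, f x = 0) →
      (∑ x ∈ A, |f x| ^ p) ^ (1 / p) ≤
        K * (∑ x ∈ A, |G.lap f x| ^ (p * d / (d + 2 * p))) ^ (1 / (p * d / (d + 2 * p))) := by
  classical
  obtain ⟨κ, hκ0, hκ⟩ := hIS
  have hp0 : 0 < p := by linarith
  have hd0 : 0 < d := by linarith
  have hpd : d + 2 * p < p * d := by rwa [one_lt_div (by positivity)] at hQ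
  set Q := p * d / (d + 2 * p) with hQdef
  set s := p * (d - 2) / d with hs
  set m := p * (d - 1) / d with hm
  set r := d / (d - 1) with hr
  have hs1 : 1 < s := by rw [hs, one_lt_div hd0]; linarith
  have hm1 : 1 ≤ m := by rw [hm, one_le_div hd0]; linarith
  have h2m : 2 * m = s + p := by rw [hm, hs]; field_simp; ring
  have hr1 : 1 ≤ r := by rw [hr, one_le_div (by linarith)]; linarith
  have hd1 : d - 1 ≠ 0 := by linarith
  have h1r : 1 / r = 1 - 1 / d := by rw [hr]; field_simp
  set C := m ^ 2 / min 1 (s - 1) with hC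
  have hc0 : 0 < min 1 (s - 1) := lt_min one_pos (by linarith)
  have hC0 : 0 ≤ C := by positivity
  refine ⟨κ ^ 2 * (4 * C * D), by positivity, fun A f hf => ?_⟩
  set U := (∑ x ∈ A, |G.lap f x| ^ Q) ^ (1 / Q) with hU
  have hU0 : 0 ≤ U := by positivity
  set S := ∑ x ∈ A, |f x| ^ p with hS
  have hS0 : 0 ≤ S := by positivity
  rcases hS0.eq_or_lt with hS0 | hSpos
  · rw [← hS0, Real.zero_rpow (by positivity)]; positivity
  set B := A ∪ A.biUnion G.nbr with hBdef
  have hAB : A ⊆ B := Finset.subset_union_left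
  have hB : ∀ x ∈ A, G.nbr x ⊆ B := fun x hx =>
    (Finset.subset_biUnion_of_mem G.nbr hx).trans Finset.subset_union_right
  set ψ : X → ℝ := fun x => f x * |f x| ^ (s - 2) with hψ
  have hψA : ∀ x ∉ A, ψ x = 0 := fun x hx => by simp [hψ, hf x hx]
  have hψabs : ∀ x, |ψ x| = |f x| ^ (s - 1) := by
    intro x
    rw [hψ, abs_mul, abs_of_nonneg (Real.rpow_nonneg (abs_nonneg _) _),
      ← Real.rpow_one_add' (abs_nonneg _) (by linarith)]
    congr 1; ring
  -- the Sobolev inequality for `|f| ^ m`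
  have hsob : S ^ (1 / r) ≤ κ * ∑ e ∈ G.edgesIn B, |(|f e.1| ^ m - |f e.2| ^ m)| := by
    have h := G.sobolev_of_isoperimetric hr1 (by rwa [h1r]) A (fun x => |f x| ^ m)
      (fun x => by positivity) (fun x hx => by
        simp only [hf x hx, abs_zero]; exact Real.zero_rpow (by linarith))
    have e1 : ∑ x ∈ A, (|f x| ^ m) ^ r = S := by
      refine Finset.sum_congr rfl fun x _ => ?_
      rw [← Real.rpow_mul (abs_nonneg _)]
      congr 1; rw [hm, hr]; field_simp
    rw [e1] at h
    refine h.trans (mul_le_mul_of_nonneg_left ?_ hκ0.le)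
    rw [G.sum_edgesIn B fun x y => |(|f x| ^ m - |f y| ^ m)|]
    refine le_trans (Finset.sum_le_sum fun x hx => ?_)
      (Finset.sum_le_sum_of_subset_of_nonneg hAB fun x _ _ =>
        Finset.sum_nonneg fun y _ => abs_nonneg _)
    refine le_trans (Finset.sum_le_sum fun y _ => max_le (le_abs_self _) (abs_nonneg _))
      (Finset.sum_le_sum_of_subset_of_nonneg ?_ fun y _ _ => abs_nonneg _)
    exact fun y hy => Finset.mem_filter.2 ⟨hB x hx hy, hy⟩
  have hCS : (∑ e ∈ G.edgesIn B, |(|f e.1| ^ m - |f e.2| ^ m)|) ^ 2 ≤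
      (∑ e ∈ G.edgesIn B, C * ((f e.1 - f e.2) * (ψ e.1 - ψ e.2))) *
        ∑ e ∈ G.edgesIn B, (|f e.1| ^ p + |f e.2| ^ p) := by
    refine Finset.sum_sq_le_sum_mul_sum_of_sq_le_mul _ (fun e _ => ?_) (fun e _ => by positivity)
      fun e _ => ?_
    · exact mul_nonneg hC0 (sq_abs_rpow_sub_abs_rpow_le hs1 hm1 h2m _ _).1
    · rw [sq_abs]
      exact (sq_abs_rpow_sub_abs_rpow_le hs1 hm1 h2m _ _).2
  have hE : ∑ e ∈ G.edgesIn B, C * ((f e.1 - f e.2) * (ψ e.1 - ψ e.2)) ≤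
      C * (2 * (U * S ^ (1 - 1 / Q))) := by
    rw [← Finset.mul_sum, G.sum_edgesIn_grad_mul_grad hAB hB f ψ hψA]
    have hpd' : p * d - d - 2 * p ≠ 0 := by linarith
    have hQ' : 1 - 1 / Q = 1 / (p * d / (p * d - d - 2 * p)) := by
      rw [hQdef]; field_simp; ring
    have hconj : Q.HolderConjugate (p * d / (p * d - d - 2 * p)) := by
      rw [Real.holderConjugate_iff]
      refine ⟨hQ, ?_⟩
      rw [← one_div, ← one_div, ← hQ']; ring
    have h := Real.inner_le_Lp_mul_Lq A (G.lap f) ψ hconj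
    have e1 : ∑ x ∈ A, |ψ x| ^ (p * d / (p * d - d - 2 * p)) = S := by
      refine Finset.sum_congr rfl fun x _ => ?_
      rw [hψabs, ← Real.rpow_mul (abs_nonneg _)]
      congr 1
      rw [hs, mul_div_assoc', div_eq_iff hpd']
      field_simp
      ring
    rw [e1, ← hQ'] at h
    gcongr
  have hW : ∑ e ∈ G.edgesIn B, (|f e.1| ^ p + |f e.2| ^ p) ≤ 2 * (D * S) := by
    rw [Finset.sum_add_distrib, G.sum_edgesIn_swap B fun x _ => |f x| ^ p, ← two_mul]
    have h := G.sum_edgesIn_fst_le hval B (fun x => |f x| ^ p) fun x => by positivity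
    have e1 : ∑ x ∈ B, |f x| ^ p = S := by
      symm
      refine Finset.sum_subset hAB fun x _ hx => ?_
      rw [hf x hx, abs_zero, Real.zero_rpow hp0.ne']
    rw [e1] at h
    gcongr
  have hfin : (S ^ (1 / r)) ^ 2 ≤ κ ^ 2 * (4 * C * D) * U * (S * S ^ (1 - 1 / Q)) := by
    calc (S ^ (1 / r)) ^ 2
        ≤ (κ * ∑ e ∈ G.edgesIn B, |(|f e.1| ^ m - |f e.2| ^ m)|) ^ 2 := by gcongr
      _ = κ ^ 2 * (∑ e ∈ G.edgesIn B, |(|f e.1| ^ m - |f e.2| ^ m)|) ^ 2 := by ring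
      _ ≤ κ ^ 2 * (C * (2 * (U * S ^ (1 - 1 / Q))) * (2 * (D * S))) := by
          refine mul_le_mul_of_nonneg_left (hCS.trans ?_) (by positivity)
          exact mul_le_mul hE hW (by positivity) (by positivity)
      _ = _ := by ring
  have e3 : (S ^ (1 / r)) ^ 2 = S ^ (1 / p) * (S * S ^ (1 - 1 / Q)) := by
    nth_rewrite 3 [← Real.rpow_one S]
    rw [← Real.rpow_natCast, ← Real.rpow_mul hSpos.le, ← Real.rpow_add hSpos,
      ← Real.rpow_add hSpos, h1r, hQdef]
    congr 1; push_cast; field_simp; ring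
  rw [e3] at hfin
  exact le_of_mul_le_mul_right hfin (by positivity)

open Classical in
/-- Solvability of the Dirichlet problem on a finite set `A`, given uniqueness. -/
lemma exists_dirichlet_solution (G : LFGraph X) (A : Finset X)
    (huniq : ∀ f : X → ℝ, (∀ x ∉ A, f x = 0) → (∀ x ∈ A, G.lap f x = 0) → ∀ x ∈ A, f x = 0)
    (u : X → ℝ) : ∃ f : X → ℝ, (∀ x ∉ A, f x = 0) ∧ ∀ x ∈ A, G.lap f x = u x := by
  let ext : (A → ℝ) → X → ℝ := fun v x => if h : x ∈ A then v ⟨x, h⟩ else 0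
  have ext_add : ∀ v w x, ext (v + w) x = ext v x + ext w x := by
    intro v w x
    by_cases h : x ∈ A <;> simp [ext, h]
  have ext_smul : ∀ (c : ℝ) v x, ext (c • v) x = c * ext v x := by
    intro c v x
    by_cases h : x ∈ A <;> simp [ext, h]
  have ext_off : ∀ v, ∀ x ∉ A, ext v x = 0 := fun v x hx => by simp [ext, hx]
  let T : (A → ℝ) →ₗ[ℝ] (A → ℝ) :=
    { toFun := fun v x => G.lap (ext v) x
      map_add' := by
        intro v w
        funext x
        simp only [lap, ext_add, Pi.add_apply]
        rw [← Finset.sum_add_distrib]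
        exact Finset.sum_congr rfl fun y _ => by ring
      map_smul' := by
        intro c v
        funext x
        simp only [lap, ext_smul, Pi.smul_apply, smul_eq_mul, RingHom.id_apply, Finset.mul_sum]
        exact Finset.sum_congr rfl fun y _ => by ring }
  have hinj : Function.Injective T := by
    rw [injective_iff_map_eq_zero]
    intro v hv
    funext x
    have h := huniq (ext v) (ext_off v) (fun y hy => congrFun hv ⟨y, hy⟩) x x.2
    simpa [ext] using h
  obtain ⟨v, hv⟩ := LinearMap.injective_iff_surjective.1 hinj fun x => u x
  exact ⟨ext v, ext_off v, fun x hx => congrFun hv ⟨x, hx⟩⟩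

/-- The Poisson equation `lap f = u` with `u ∈ ℓ^Q` has a solution in `ℓ^p`, where
`1 / Q = 1 / p + 2 / d`. -/
lemma exists_lap_eq (G : LFGraph X) {D : ℕ} (hval : G.BddVal D) {d p : ℝ}
    (hIS : G.ISdim d) (hp : 1 ≤ p) (hd : 2 < d) (hQ : 1 < p * d / (d + 2 * p))
    (u : X → ℝ) (hu : lpMem (p * d / (d + 2 * p)) u) :
    ∃ f : X → ℝ, lpMem p f ∧ ∀ x, G.lap f x = u x := by
  classical
  obtain ⟨K, hK0, hK⟩ := G.exists_dirichlet_estimate hval hIS hp hd hQ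
  set Q := p * d / (d + 2 * p)
  have hp0 : 0 < p := by linarith
  have hsol : ∀ A : Finset X, ∃ f : X → ℝ, (∀ x ∉ A, f x = 0) ∧ ∀ x ∈ A, G.lap f x = u x := by
    intro A
    refine G.exists_dirichlet_solution A (fun f hf hlap x hx => ?_) u
    have h := hK A f hf
    have h0 : ∑ x ∈ A, |G.lap f x| ^ Q = 0 := Finset.sum_eq_zero fun x hx => by
      rw [hlap x hx, abs_zero, Real.zero_rpow (by linarith)]
    rw [h0, Real.zero_rpow (by positivity), mul_zero] at h
    have hS0 : 0 ≤ ∑ x ∈ A, |f x| ^ p := by positivity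
    have hS : ∑ x ∈ A, |f x| ^ p = 0 := by
      by_contra hne
      exact absurd h (not_le.2 (Real.rpow_pos_of_pos (lt_of_le_of_ne hS0 (Ne.symm hne)) _))
    have := (Finset.sum_eq_zero_iff_of_nonneg fun x _ => by positivity).1 hS x hx
    rw [Real.rpow_eq_zero (abs_nonneg _) hp0.ne'] at this
    exact abs_eq_zero.1 this
  choose F hF0 hFlap using hsol
  set M := (K * (∑' x, |u x| ^ Q) ^ (1 / Q)) ^ p with hM
  have hbound : ∀ A B : Finset X, ∑ x ∈ B, |F A x| ^ p ≤ M := by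
    intro A B
    have h1 : ∑ x ∈ B, |F A x| ^ p ≤ ∑ x ∈ A, |F A x| ^ p := by
      calc _ ≤ ∑ x ∈ A ∪ B, |F A x| ^ p :=
            Finset.sum_le_sum_of_subset_of_nonneg Finset.subset_union_right
              fun _ _ _ => by positivity
        _ = _ := (Finset.sum_subset Finset.subset_union_left fun x _ hx => by
            rw [hF0 A x hx, abs_zero, Real.zero_rpow hp0.ne']).symm
    have h2 := hK A (F A) (hF0 A)
    have h3 : ∑ x ∈ A, |G.lap (F A) x| ^ Q ≤ ∑' x, |u x| ^ Q := by
      rw [Finset.sum_congr rfl fun x hx => by rw [hFlap A x hx]]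
      exact Summable.sum_le_tsum A (fun _ _ => by positivity) hu
    have h4 : (∑ x ∈ A, |F A x| ^ p) ^ (1 / p) ≤ K * (∑' x, |u x| ^ Q) ^ (1 / Q) :=
      h2.trans (mul_le_mul_of_nonneg_left
        (Real.rpow_le_rpow (by positivity) h3 (by positivity)) hK0)
    have h5 := Real.rpow_le_rpow (by positivity) h4 hp0.le
    rw [← Real.rpow_mul (by positivity), one_div_mul_cancel hp0.ne', Real.rpow_one] at h5
    exact h1.trans h5
  have hM0 : 0 ≤ M := by simpa using hbound ∅ ∅
  have hpt : ∀ A x, F A x ∈ Set.Icc (-(M ^ (1 / p))) (M ^ (1 / p)) := by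
    intro A x
    rw [← abs_le.trans Set.mem_Icc.symm]
    have h := hbound A {x}
    rw [Finset.sum_singleton] at h
    have h' := Real.rpow_le_rpow (by positivity) h (by positivity : 0 ≤ 1 / p)
    rwa [← Real.rpow_mul (abs_nonneg _), mul_one_div_cancel hp0.ne', Real.rpow_one] at h'
  let 𝒰 : Ultrafilter (Finset X) := Ultrafilter.of atTop
  have hlim : ∀ x, ∃ l : ℝ, Tendsto (fun A => F A x) 𝒰 (𝓝 l) := by
    intro x
    obtain ⟨l, -, hl⟩ := isCompact_Icc.ultrafilter_le_nhds (𝒰.map fun A => F A x)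
      (tendsto_principal.2 (Eventually.of_forall fun A => hpt A x))
    exact ⟨l, hl⟩
  choose f hf using hlim
  refine ⟨f, ?_, fun x => ?_⟩
  · refine summable_of_sum_le (c := M) (fun _ => by positivity) fun B => ?_
    have ht : Tendsto (fun A => ∑ x ∈ B, |F A x| ^ p) 𝒰 (𝓝 (∑ x ∈ B, |f x| ^ p)) :=
      tendsto_finsetSum _ fun x _ => (hf x).abs.rpow_const (Or.inr hp0.le)
    exact le_of_tendsto' ht fun A => hbound A B
  · have ht : Tendsto (fun A => G.lap (F A) x) 𝒰 (𝓝 (G.lap f x)) :=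
      tendsto_finsetSum _ fun y _ => (hf x).sub (hf y)
    have hev : ∀ᶠ A in (𝒰 : Filter (Finset X)), u x = G.lap (F A) x := by
      refine Ultrafilter.of_le atTop ?_
      filter_upwards [eventually_ge_atTop {x}] with A hA
      exact (hFlap A x (hA (Finset.mem_singleton_self x))).symm
    exact tendsto_nhds_unique ht (tendsto_const_nhds.congr' hev)

/-- The oriented edges, listed by their origin. -/
def sigmaEquivEdge (G : LFGraph X) : (Σ x : X, {y // y ∈ G.nbr x}) ≃ G.Edge where
  toFun e := ⟨(e.1, e.2.1), e.2.2⟩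
  invFun e := ⟨e.1.1, e.1.2, e.2⟩
  left_inv _ := rfl
  right_inv _ := rfl

/-- Reversal of oriented edges. -/
def edgeSwap (G : LFGraph X) : G.Edge ≃ G.Edge where
  toFun e := ⟨(e.1.2, e.1.1), (G.symm _ _).1 e.2⟩
  invFun e := ⟨(e.1.2, e.1.1), (G.symm _ _).1 e.2⟩
  left_inv _ := rfl
  right_inv _ := rfl

lemma _root_.lpMem.mono {ι : Type*} {p q : ℝ} (hp : 0 < p) (hpq : p ≤ q) {f : ι → ℝ}
    (hf : lpMem p f) : lpMem q f := by
  refine Summable.of_norm_bounded_eventually (g := fun i => |f i| ^ p) hf ?_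
  filter_upwards [hf.tendsto_cofinite_zero.eventually_le_const one_pos] with i hi
  have h1 : |f i| ≤ 1 := by
    by_contra h
    exact absurd hi (not_le.2 (Real.one_lt_rpow (not_le.1 h) hp))
  rw [Real.norm_of_nonneg (by positivity)]
  rcases (abs_nonneg (f i)).eq_or_lt with h0 | h0
  · rw [← h0, Real.zero_rpow hp.ne', Real.zero_rpow (by linarith)]
  · exact Real.rpow_le_rpow_of_exponent_ge h0 h1 hpq

lemma _root_.lpMem.boundedFun {ι : Type*} {p : ℝ} (hp : 0 < p) {f : ι → ℝ}
    (hf : lpMem p f) : BoundedFun f := by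
  refine ⟨(∑' i, |f i| ^ p) ^ (1 / p), fun i => ?_⟩
  have h := Real.rpow_le_rpow (by positivity) (hf.le_tsum i fun _ _ => by positivity)
    (by positivity : 0 ≤ 1 / p)
  rwa [← Real.rpow_mul (abs_nonneg _), mul_one_div_cancel hp.ne', Real.rpow_one] at h

lemma abs_add_rpow_le {q : ℝ} (hq : 1 ≤ q) (a b : ℝ) :
    |a + b| ^ q ≤ 2 ^ (q - 1) * (|a| ^ q + |b| ^ q) :=
  (Real.rpow_le_rpow (abs_nonneg _) (abs_add_le a b) (by linarith)).trans
    (by exact_mod_cast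
      NNReal.rpow_add_le_mul_rpow_add_rpow ⟨|a|, abs_nonneg a⟩ ⟨|b|, abs_nonneg b⟩ hq)

lemma MemDp.lpMem_lap {G : LFGraph X} {D : ℕ} (hval : G.BddVal D) {q : ℝ} (hq : 1 ≤ q)
    {g : X → ℝ} (hg : G.MemDp q g) : lpMem q (G.lap g) := by
  have h1 : Summable fun e : Σ x : X, {y // y ∈ G.nbr x} => |g e.2.1 - g e.1| ^ q :=
    (G.sigmaEquivEdge.summable_iff (f := fun e => |G.grad g e| ^ q)).2 hg
  have h2 := h1.sigma
  refine Summable.of_nonneg_of_le (fun _ => by positivity) (fun x => ?_)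
    (h2.mul_left ((D : ℝ) ^ (q - 1)))
  rw [tsum_fintype, Finset.sum_coe_sort (G.nbr x) fun y => |g y - g x| ^ q, lap]
  calc |∑ y ∈ G.nbr x, (g x - g y)| ^ q ≤ (∑ y ∈ G.nbr x, |g y - g x|) ^ q := by
        refine Real.rpow_le_rpow (abs_nonneg _) ?_ (by linarith)
        refine (Finset.abs_sum_le_sum_abs _ _).trans_eq ?_
        exact Finset.sum_congr rfl fun y _ => abs_sub_comm _ _
    _ ≤ _ := Real.rpow_sum_le_const_mul_sum_rpow _ _ hq
    _ ≤ _ := by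
        refine mul_le_mul_of_nonneg_right ?_ (by positivity)
        exact Real.rpow_le_rpow (by positivity) (by exact_mod_cast hval x) (by linarith)

lemma _root_.lpMem.memDp {G : LFGraph X} {D : ℕ} (hval : G.BddVal D) {p : ℝ} (hp : 1 ≤ p)
    {f : X → ℝ} (hf : lpMem p f) : G.MemDp p f := by
  have h1 : Summable fun e : G.Edge => |f e.1.1| ^ p := by
    rw [← G.sigmaEquivEdge.summable_iff]
    refine (summable_sigma_of_nonneg fun _ => Real.rpow_nonneg (abs_nonneg _) _).2
      ⟨fun x => Summable.of_finite, ?_⟩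
    refine Summable.of_nonneg_of_le (fun x => tsum_nonneg fun _ =>
      Real.rpow_nonneg (abs_nonneg _) _) (fun x => ?_)
      (hf.mul_left (D : ℝ))
    rw [tsum_fintype]
    simp only [sigmaEquivEdge, Equiv.coe_fn_mk, Finset.sum_const, nsmul_eq_mul]
    refine mul_le_mul_of_nonneg_right ?_ (by positivity)
    simpa using hval x
  have h2 : Summable fun e : G.Edge => |f e.1.2| ^ p := (G.edgeSwap.summable_iff).2 h1
  refine Summable.of_nonneg_of_le (fun _ => by positivity) (fun e => ?_)
    ((h2.add h1).mul_left (2 ^ (p - 1)))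
  rw [grad, sub_eq_add_neg]
  simpa using abs_add_rpow_le hp (f e.1.2) (-(f e.1.1))

/-- If bounded harmonic functions with `ℓ^p` gradient are constant, then bounded functions in `D^q`
are, up to a constant, in `ℓ^p`. -/
lemma exists_lpMem_sub_const (G : LFGraph X) {D : ℕ} (hval : G.BddVal D) {d p q : ℝ}
    (hIS : G.ISdim d) (hp : 1 ≤ p) (hd : 2 < d)
    (hharm : ∀ h : X → ℝ, G.Harmonic h → BoundedFun h → G.MemDp p h → ∀ x y, h x = h y)
    (hq1 : 1 ≤ q) (hq2 : q < p * d / (d + 2 * p)) (x₀ : X) {g : X → ℝ}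
    (hg : G.MemDp q g) (hb : BoundedFun g) : ∃ c : ℝ, lpMem p fun x => g x - c := by
  have hQp : p * d / (d + 2 * p) ≤ p := by
    rw [div_le_iff₀ (by positivity)]; nlinarith
  obtain ⟨f, hfp, hf⟩ := G.exists_lap_eq hval hIS hp hd (hq1.trans_lt hq2) (G.lap g)
    (MemDp.lpMem_lap hval hq1 hg |>.mono (by linarith) hq2.le)
  have hgp : G.MemDp p g := lpMem.mono (by linarith) (hq2.le.trans hQp) hg
  have hconst := hharm (fun x => g x - f x) (fun x => ?_) ?_ ?_
  · refine ⟨g x₀ - f x₀, ?_⟩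
    convert hfp using 2 with x
    rw [hconst x₀ x]; ring
  · have h := hf x
    simp only [lap, Finset.sum_sub_distrib, Finset.sum_const, nsmul_eq_mul] at h ⊢
    linarith
  · obtain ⟨M, hM⟩ := hb
    obtain ⟨N, hN⟩ := lpMem.boundedFun (by linarith) hfp
    exact ⟨M + N, fun x => (abs_sub _ _).trans (add_le_add (hM x) (hN x))⟩
  · have hfD : G.MemDp p f := hfp.memDp hval hp
    refine Summable.of_nonneg_of_le (fun _ => by positivity) (fun e => ?_)
      ((Summable.add hgp hfD).mul_left (2 ^ (p - 1)))
    have h := abs_add_rpow_le hp (G.grad g e) (-(G.grad f e))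
    rw [abs_neg] at h
    convert h using 3
    simp only [grad]; ring

lemma MemDp.comp {G : LFGraph X} {q : ℝ} (hq : 0 ≤ q) {g : X → ℝ} (hg : G.MemDp q g) {φ : ℝ → ℝ}
    (hφ : ∀ a b, |φ a - φ b| ≤ |a - b|) : G.MemDp q fun x => φ (g x) :=
  Summable.of_nonneg_of_le (fun _ => by positivity)
    (fun _ => Real.rpow_le_rpow (abs_nonneg _) (hφ _ _) hq) hg

/-- If contractions `φ n` of the real line converge pointwise to `0`, then the gradient of
`φ n ∘ g` converges to `0` in `ℓ^q`. -/
lemma MemDp.tendsto_tsum_grad_comp {G : LFGraph X} {q : ℝ} (hq : 0 < q) {g : X → ℝ}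
    (hg : G.MemDp q g) {φ : ℕ → ℝ → ℝ} (hφ : ∀ n a b, |φ n a - φ n b| ≤ |a - b|)
    (hlim : ∀ a, Tendsto (fun n => φ n a) atTop (𝓝 0)) :
    Tendsto (fun n => ∑' e, |G.grad (fun x => φ n (g x)) e| ^ q) atTop (𝓝 0) := by
  have h := tendsto_tsum_of_dominated_convergence (𝓕 := atTop)
    (f := fun n e => |G.grad (fun x => φ n (g x)) e| ^ q) (g := fun _ => (0 : ℝ)) hg
    (fun e => ?_) (Eventually.of_forall fun n e => ?_)
  · simpa using h
  · have := (((hlim (g e.1.2)).sub (hlim (g e.1.1))).abs).rpow_const (p := q) (Or.inr hq.le)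
    simpa [grad, Real.zero_rpow hq.ne'] using this
  · rw [Real.norm_of_nonneg (by positivity)]
    exact Real.rpow_le_rpow (abs_nonneg _) (hφ _ _ _) hq.le

/-- Truncation of a real number at height `t`. -/
def clamp (t a : ℝ) : ℝ := max (-t) (min t a)

lemma abs_clamp_sub_clamp_le (t a b : ℝ) : |clamp t a - clamp t b| ≤ |a - b| := by
  refine (abs_max_sub_max_le_max _ _ _ _).trans (max_le (by simp) ?_)
  exact (abs_min_sub_min_le_max _ _ _ _).trans (max_le (by simp) le_rfl)

lemma clamp_of_abs_le {t a : ℝ} (h : |a| ≤ t) : clamp t a = a := by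
  rw [clamp, min_eq_right (abs_le.1 h).2, max_eq_right (abs_le.1 h).1]

lemma abs_clamp_le {t : ℝ} (ht : 0 ≤ t) (a : ℝ) : |clamp t a| ≤ t :=
  abs_le.2 ⟨le_max_left _ _, max_le (by linarith) (min_le_left _ _)⟩

lemma abs_sub_clamp_sub_sub_clamp_le {t : ℝ} (ht : 0 ≤ t) (a b : ℝ) :
    |(a - clamp t a) - (b - clamp t b)| ≤ |a - b| := by
  simp only [clamp]
  grind

lemma tendsto_sub_clamp (a : ℝ) : Tendsto (fun n : ℕ => a - clamp n a) atTop (𝓝 0) := by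
  refine tendsto_const_nhds.congr' ?_
  filter_upwards [tendsto_natCast_atTop_atTop.eventually_ge_atTop |a|] with n hn
  rw [clamp_of_abs_le hn, sub_self]

lemma tendsto_clamp_one_div (a : ℝ) :
    Tendsto (fun n : ℕ => clamp (1 / ((n : ℝ) + 1)) a) atTop (𝓝 0) :=
  squeeze_zero_norm (fun _ => abs_clamp_le (by positivity) _)
    tendsto_one_div_add_atTop_nhds_zero_nat

/-- A function tending to `0` at infinity differs from its truncation by a finitely supported
function. -/
lemma lpMem_sub_clamp {ι : Type*} {p q t : ℝ} (hp : 0 < p) (hq : 0 < q) (ht : 0 < t) {k : ι → ℝ}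
    (hk : lpMem p k) : lpMem q fun x => k x - clamp t (k x) := by
  have hfin : {x | ¬ |k x| ^ p ≤ t ^ p}.Finite :=
    hk.tendsto_cofinite_zero.eventually_le_const (Real.rpow_pos_of_pos ht p)
  refine summable_of_hasFiniteSupport (hfin.subset fun x hx hle => hx ?_)
  have : |k x| ≤ t := (Real.rpow_le_rpow_iff (abs_nonneg _) ht.le hp).1 hle
  simp [clamp_of_abs_le this, Real.zero_rpow hq.ne']

end LFGraph

/-- If `Γ` has `IS_d`, `1 ≤ p < d/2`, and every bounded harmonic
function with gradient in `ℓ^p(E)` is constant, then for every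
`1 ≤ q < pd/(d+2p)` the reduced `ℓ^q`-cohomology in degree one is trivial. -/
theorem stmt2 {X : Type*} (G : LFGraph X) (hconn : G.Conn) (D : ℕ) (hval : G.BddVal D)
    (d p : ℝ) (hIS : G.ISdim d) (hp : 1 ≤ p) (hpd : p < d / 2)
    (hharm : ∀ h : X → ℝ, G.Harmonic h → BoundedFun h → G.MemDp p h → ∀ x y, h x = h y)
    (q : ℝ) (hq1 : 1 ≤ q) (hq2 : q < p * d / (d + 2 * p))
    (e0 : X) (g : X → ℝ) (hg : G.MemDp q g) : G.InClos q e0 g := by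
  intro ε hε
  have hd : 2 < d := by linarith
  have hp0 : 0 < p := by linarith
  have hq0 : 0 < q := by linarith
  have hη : 0 < ε ^ q / 2 ^ q := by positivity
  obtain ⟨N, hN⟩ := ((hg.tendsto_tsum_grad_comp hq0 (φ := fun n a => a - LFGraph.clamp n a)
    (fun n => LFGraph.abs_sub_clamp_sub_sub_clamp_le n.cast_nonneg)
    LFGraph.tendsto_sub_clamp).eventually_lt_const hη).exists
  have hgN : G.MemDp q fun x => LFGraph.clamp N (g x) :=
    hg.comp hq0.le (LFGraph.abs_clamp_sub_clamp_le N)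
  obtain ⟨c, hc⟩ := G.exists_lpMem_sub_const hval hIS hp hd hharm hq1 hq2 e0 hgN
    ⟨N, fun x => LFGraph.abs_clamp_le N.cast_nonneg _⟩
  have hk : G.MemDp q fun x => LFGraph.clamp N (g x) - c := hgN.comp (φ := fun a => a - c) hq0.le
    fun a b => by simp
  obtain ⟨n, hn⟩ := ((hk.tendsto_tsum_grad_comp hq0
    (φ := fun n a => LFGraph.clamp (1 / ((n : ℝ) + 1)) a)
    (fun n => LFGraph.abs_clamp_sub_clamp_le _)
    LFGraph.tendsto_clamp_one_div).eventually_lt_const hη).exists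
  set t : ℝ := 1 / ((n : ℝ) + 1)
  have ht : 0 < t := by positivity
  set a : X → ℝ := fun x => g x - LFGraph.clamp N (g x) with ha
  set b : X → ℝ := fun x => LFGraph.clamp t (LFGraph.clamp N (g x) - c) with hb
  have haD : G.MemDp q a := hg.comp (φ := fun a => a - LFGraph.clamp N a) hq0.le
    (LFGraph.abs_sub_clamp_sub_sub_clamp_le N.cast_nonneg)
  have hbD : G.MemDp q b := hk.comp hq0.le (LFGraph.abs_clamp_sub_clamp_le t)
  set f : X → ℝ := fun x => (LFGraph.clamp N (g x) - c) - b x with hf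
  set c' : ℝ := c + (a e0 + b e0) with hc'
  have hle : ∀ e : G.Edge, |G.grad (fun x => g x - (f x + c')) e| ^ q ≤
      2 ^ (q - 1) * (|G.grad a e| ^ q + |G.grad b e| ^ q) := by
    intro e
    convert LFGraph.abs_add_rpow_le hq1 (G.grad a e) (G.grad b e) using 3
    simp only [LFGraph.grad, hf, ha]
    ring
  have hsum : Summable fun e => 2 ^ (q - 1) * (|G.grad a e| ^ q + |G.grad b e| ^ q) :=
    (Summable.add haD hbD).mul_left _
  have hD : G.MemDp q fun x => g x - (f x + c') :=
    Summable.of_nonneg_of_le (fun _ => by positivity) hle hsum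
  refine ⟨f, c', LFGraph.lpMem_sub_clamp hp0 hq0 ht hc, hD, ?_⟩
  have h0 : g e0 - (f e0 + c') = 0 := by
    simp only [hf, hc', ha]
    ring
  have hlt : ∑' e, |G.grad (fun x => g x - (f x + c')) e| ^ q < ε ^ q := by
    calc _ ≤ ∑' e, 2 ^ (q - 1) * (|G.grad a e| ^ q + |G.grad b e| ^ q) := hD.tsum_le_tsum hle hsum
      _ = 2 ^ (q - 1) * (∑' e, |G.grad a e| ^ q + ∑' e, |G.grad b e| ^ q) := by
          rw [tsum_mul_left, Summable.tsum_add haD hbD]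
      _ < 2 ^ (q - 1) * (ε ^ q / 2 ^ q + ε ^ q / 2 ^ q) := by gcongr
      _ = ε ^ q := by
          rw [Real.rpow_sub_one two_ne_zero]
          field_simp
          ring
  rw [LFGraph.dpDist, h0, abs_zero, add_zero, LFGraph.gradNorm]
  calc _ < (ε ^ q) ^ (1 / q) :=
        Real.rpow_lt_rpow (tsum_nonneg fun _ => by positivity) hlt (by positivity)
    _ = ε := by rw [← Real.rpow_mul hε.le, mul_one_div_cancel hq0.ne', Real.rpow_one]
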